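/- For every n ≥ 0, the abelian complexity function ρ of the ordinary paperfolding word satisfies ρ(16n+3) = ρ(2n+1) + 2. -/

import Mathlib

/-- The ordinary paperfolding word over `{0,1}`, indexed from 1:
writing `n = n' * 2^k` with `n'` odd, `pf n = 0` if `n' ≡ 1 (mod 4)`
and `pf n = 1` if `n' ≡ 3 (mod 4)`.  (The value at `0` is irrelevant.) -/
def pf (n : ℕ) : ℕ := if (n / 2 ^ (n.factorization 2)) % 4 = 1 then 0 else 1

/-- The factor `f_i f_{i+1} ⋯ f_{i+n-1}` of the paperfolding word,
of length `n`, starting at position `i`. -/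
def pfFactor (i n : ℕ) : List ℕ := (List.range n).map (fun j => pf (i + j))

/-- `w` is a factor of the ordinary paperfolding word. -/
def IsPFFactor (w : List ℕ) : Prop := ∃ i : ℕ, 1 ≤ i ∧ w = pfFactor i w.length

/-- The abelian complexity function of the ordinary paperfolding word:
the number of abelian equivalence classes of factors of length `n`,
where the class of a factor `w` is determined by the pair
`(|w|_0, |w|_1)` of numbers of occurrences of `0` and `1` in `w`. -/
noncomputable def ρ (n : ℕ) : ℕ :=
  {p : ℕ × ℕ | ∃ i : ℕ, 1 ≤ i ∧
    p = ((pfFactor i n).count 0, (pfFactor i n).count 1)}.ncard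

/-- `Δ w = |w|_0 - |w|_1`. -/
def Δ (w : List ℕ) : ℤ := (w.count 0 : ℤ) - (w.count 1 : ℤ)

/-- `M n` is the maximum of `Δ w` over all factors `w` of the
paperfolding word of length `n`. -/
noncomputable def M (n : ℕ) : ℤ :=
  sSup {d : ℤ | ∃ i : ℕ, 1 ≤ i ∧ d = Δ (pfFactor i n)}

theorem pf_two_mul {k : ℕ} (hk : k ≠ 0) : pf (2 * k) = pf k := by
  have h : (2 * k).factorization 2 = k.factorization 2 + 1 := by
    rw [Nat.factorization_mul two_ne_zero hk]
    simp [Nat.Prime.factorization Nat.prime_two, add_comm]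
  unfold pf
  rw [h, pow_succ', Nat.mul_div_mul_left _ _ two_pos]

theorem pf_two_mul_add_one (k : ℕ) : pf (2 * k + 1) = k % 2 := by
  have h : (2 * k + 1).factorization 2 = 0 :=
    Nat.factorization_eq_zero_of_not_dvd (by omega)
  unfold pf
  rw [h, pow_zero, Nat.div_one]
  split_ifs <;> omega

theorem pf_le_one (n : ℕ) : pf n ≤ 1 := by
  unfold pf
  split_ifs <;> omega

/-- The number of ones among the first `k` letters of the paperfolding word. -/
def prefixOnes (k : ℕ) : ℕ := ∑ j ∈ Finset.range k, pf (j + 1)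

theorem prefixOnes_succ (k : ℕ) : prefixOnes (k + 1) = prefixOnes k + pf (k + 1) :=
  Finset.sum_range_succ _ _

theorem prefixOnes_two_mul (k : ℕ) : prefixOnes (2 * k) = prefixOnes k + k / 2 := by
  induction k with
  | zero => rfl
  | succ k ih =>
    have h : pf (2 * k + 1 + 1) = pf (k + 1) := pf_two_mul (k := k + 1) (by omega)
    rw [show 2 * (k + 1) = 2 * k + 1 + 1 by ring, prefixOnes_succ, prefixOnes_succ,
      prefixOnes_succ, ih, pf_two_mul_add_one, h]
    omega

theorem prefixOnes_two_mul_add_one (k : ℕ) :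
    prefixOnes (2 * k + 1) = prefixOnes k + (k + 1) / 2 := by
  rw [prefixOnes_succ, prefixOnes_two_mul, pf_two_mul_add_one]
  omega

theorem prefixOnes_mono : Monotone prefixOnes :=
  monotone_nat_of_le_succ fun k => by rw [prefixOnes_succ]; omega

theorem prefixOnes_add_le (a n : ℕ) : prefixOnes (a + n) ≤ prefixOnes a + n := by
  induction n with
  | zero => simp
  | succ n ih =>
    have := pf_le_one (a + n + 1)
    rw [← add_assoc, prefixOnes_succ]
    omega

/-- The number of ones in the factor of length `n` that follows the first `a` letters. -/
def windowOnes (n a : ℕ) : ℕ := prefixOnes (a + n) - prefixOnes a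

theorem prefixOnes_add (a n : ℕ) : prefixOnes (a + n) = prefixOnes a + windowOnes n a := by
  have := prefixOnes_mono (Nat.le_add_right a n)
  unfold windowOnes
  omega

theorem windowOnes_le (n a : ℕ) : windowOnes n a ≤ n := by
  have := prefixOnes_add_le a n
  have := prefixOnes_add a n
  omega

theorem windowOnes_succ_bounds (n a : ℕ) :
    windowOnes n (a + 1) ≤ windowOnes n a + 1 ∧ windowOnes n a ≤ windowOnes n (a + 1) + 1 := by
  have h₁ := prefixOnes_add a n
  have h₂ := prefixOnes_add (a + 1) n
  rw [add_right_comm, prefixOnes_succ, prefixOnes_succ] at h₂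
  have := pf_le_one (a + n + 1)
  have := pf_le_one (a + 1)
  omega

theorem count_one_pfFactor (a n : ℕ) : (pfFactor (a + 1) n).count 1 = windowOnes n a := by
  induction n with
  | zero => simp [pfFactor, windowOnes]
  | succ n ih =>
    have h₁ := prefixOnes_add a n
    have h₂ := prefixOnes_add a (n + 1)
    rw [← add_assoc, prefixOnes_succ] at h₂
    unfold pfFactor at ih ⊢
    rw [List.range_succ, List.map_append, List.count_append, ih, List.map_singleton,
      List.count_singleton, add_right_comm]
    have := pf_le_one (a + n + 1)
    simp only [beq_iff_eq]
    split_ifs <;> omega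

theorem count_zero_add_count_one_pfFactor (i n : ℕ) :
    (pfFactor i n).count 0 + (pfFactor i n).count 1 = n := by
  induction n with
  | zero => simp [pfFactor]
  | succ n ih =>
    unfold pfFactor at ih ⊢
    rw [List.range_succ, List.map_append, List.count_append, List.count_append,
      List.map_singleton, List.count_singleton, List.count_singleton]
    have := pf_le_one (i + n)
    simp only [beq_iff_eq]
    split_ifs <;> omega

theorem ρ_eq_ncard_range_windowOnes (n : ℕ) : ρ n = (Set.range (windowOnes n)).ncard := by
  have hinj : Function.Injective fun u : ℕ => (n - u, u) := fun u v h => (Prod.ext_iff.1 h).2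
  rw [← Set.ncard_image_of_injective _ hinj]
  have key (a : ℕ) : ((pfFactor (a + 1) n).count 0, (pfFactor (a + 1) n).count 1) =
      (n - windowOnes n a, windowOnes n a) := by
    have h := count_zero_add_count_one_pfFactor (a + 1) n
    rw [count_one_pfFactor] at h ⊢
    exact Prod.ext (by simp only; omega) rfl
  unfold ρ
  congr 1
  ext p
  constructor
  · rintro ⟨i, hi, rfl⟩
    obtain ⟨a, rfl⟩ := Nat.exists_eq_add_of_le' hi
    exact ⟨_, ⟨a, rfl⟩, (key a).symm⟩
  · rintro ⟨_, ⟨a, rfl⟩, rfl⟩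
    exact ⟨a + 1, by omega, (key a).symm⟩

/-- A sequence of naturals with steps of size at most one takes all values between
any two of its values. -/
theorem mem_range_of_unit_steps {f : ℕ → ℕ} (hf : ∀ a, f (a + 1) ≤ f a + 1 ∧ f a ≤ f (a + 1) + 1)
    {x : ℕ} (hlo : ∃ a, f a ≤ x) (hhi : ∃ b, x ≤ f b) : x ∈ Set.range f := by
  by_contra hx
  have hne (a : ℕ) : f a ≠ x := fun h => hx ⟨a, h⟩
  have hconst (a : ℕ) : f a < x ↔ f 0 < x := by
    induction a with
    | zero => rfl
    | succ a ih =>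
      have := hf a
      have := hne a
      have := hne (a + 1)
      rw [← ih]
      omega
  obtain ⟨a, ha⟩ := hlo
  obtain ⟨b, hb⟩ := hhi
  have := (hconst b).2 ((hconst a).1 (lt_of_le_of_ne ha (hne a)))
  omega

theorem range_windowOnes_eq_Icc (n : ℕ) :
    ∃ l h, l ≤ h ∧ Set.range (windowOnes n) = Set.Icc l h := by
  have hbdd : BddAbove (Set.range (windowOnes n)) :=
    ⟨n, by rintro _ ⟨a, rfl⟩; exact windowOnes_le n a⟩
  have hne := Set.range_nonempty (windowOnes n)
  obtain ⟨a, ha⟩ := Nat.sInf_mem hne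
  obtain ⟨b, hb⟩ := Nat.sSup_mem hne hbdd
  refine ⟨_, _, (Nat.sInf_le (Set.mem_range_self b)).trans (le_csSup hbdd ⟨b, rfl⟩), ?_⟩
  refine Set.Subset.antisymm (fun x hx => ⟨Nat.sInf_le hx, le_csSup hbdd hx⟩) fun x hx => ?_
  exact mem_range_of_unit_steps (windowOnes_succ_bounds n) ⟨a, ha.trans_le hx.1⟩
    ⟨b, hx.2.trans_eq hb.symm⟩

/-- Expansion of `prefixOnes` along the last three binary digits of its argument. -/
theorem prefixOnes_eight_mul_add (k : ℕ) :
    prefixOnes (8 * k) = prefixOnes k + k / 2 + 3 * k ∧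
    prefixOnes (8 * k + 1) = prefixOnes k + k / 2 + 3 * k ∧
    prefixOnes (8 * k + 2) = prefixOnes k + k / 2 + 3 * k ∧
    prefixOnes (8 * k + 3) = prefixOnes k + k / 2 + 3 * k + 1 ∧
    prefixOnes (8 * k + 4) = prefixOnes k + (k + 1) / 2 + 3 * k + 1 ∧
    prefixOnes (8 * k + 5) = prefixOnes k + (k + 1) / 2 + 3 * k + 1 ∧
    prefixOnes (8 * k + 6) = prefixOnes k + (k + 1) / 2 + 3 * k + 2 ∧
    prefixOnes (8 * k + 7) = prefixOnes k + (k + 1) / 2 + 3 * k + 3 := by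
  have h₀ := prefixOnes_two_mul k
  have h₁ := prefixOnes_two_mul_add_one k
  have h₂ := prefixOnes_two_mul (2 * k)
  have h₃ := prefixOnes_two_mul_add_one (2 * k)
  have h₄ := prefixOnes_two_mul (2 * k + 1)
  have h₅ := prefixOnes_two_mul_add_one (2 * k + 1)
  have e₀ := prefixOnes_two_mul (2 * (2 * k))
  have e₁ := prefixOnes_two_mul_add_one (2 * (2 * k))
  have e₂ := prefixOnes_two_mul (2 * (2 * k) + 1)
  have e₃ := prefixOnes_two_mul_add_one (2 * (2 * k) + 1)
  have e₄ := prefixOnes_two_mul (2 * (2 * k + 1))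
  have e₅ := prefixOnes_two_mul_add_one (2 * (2 * k + 1))
  have e₆ := prefixOnes_two_mul (2 * (2 * k + 1) + 1)
  have e₇ := prefixOnes_two_mul_add_one (2 * (2 * k + 1) + 1)
  ring_nf at *
  omega

theorem windowOnes_sixteen_mul_add_three_bounds (n b r : ℕ) (hr : r < 8) :
    windowOnes (2 * n + 1) b + 7 * n ≤ windowOnes (16 * n + 3) (8 * b + r) ∧
    windowOnes (16 * n + 3) (8 * b + r) ≤ windowOnes (2 * n + 1) b + 7 * n + 2 := by
  have h := prefixOnes_add (8 * b + r) (16 * n + 3)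
  have h₁ := prefixOnes_add b (2 * n + 1)
  have hs := prefixOnes_succ (b + 2 * n)
  have hp := pf_le_one (b + 2 * n + 1)
  rw [← add_assoc] at h₁
  have E := prefixOnes_eight_mul_add b
  have E₁ := prefixOnes_eight_mul_add (b + 2 * n)
  have E₂ := prefixOnes_eight_mul_add (b + 2 * n + 1)
  rcases lt_or_ge r 5 with hr' | hr'
  · rw [show 8 * b + r + (16 * n + 3) = 8 * (b + 2 * n) + (r + 3) by ring] at h
    interval_cases r <;> simp only [Nat.reduceAdd, zero_add, add_zero, E, E₁] at h ⊢ <;>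
      clear E E₁ E₂ <;> omega
  · rw [show 8 * b + r + (16 * n + 3) = 8 * (b + 2 * n + 1) + (r - 5) by omega] at h
    interval_cases r <;> simp only [Nat.reduceSub, add_zero, E, E₂] at h ⊢ <;>
      clear E E₁ E₂ <;> omega

theorem exists_windowOnes_sixteen_mul_add_three (n b e : ℕ) (he : e ≤ 2) :
    ∃ a, windowOnes (16 * n + 3) a = windowOnes (2 * n + 1) b + 7 * n + e := by
  refine ⟨8 * b + (7 - e), ?_⟩
  have h := prefixOnes_add (8 * b + (7 - e)) (16 * n + 3)
  rw [show 8 * b + (7 - e) + (16 * n + 3) = 8 * (b + 2 * n + 1) + (2 - e) by omega] at h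
  have h₁ := prefixOnes_add b (2 * n + 1)
  rw [← add_assoc] at h₁
  have E := prefixOnes_eight_mul_add b
  have E₂ := prefixOnes_eight_mul_add (b + 2 * n + 1)
  interval_cases e <;> simp only [Nat.reduceSub, add_zero, E, E₂] at h ⊢ <;>
    clear E E₂ <;> omega

theorem pf_rho_sixteen_mul_add_three : ∀ n : ℕ, ρ (16 * n + 3) = ρ (2 * n + 1) + 2 := by
  intro n
  obtain ⟨l, h, hlh, hU⟩ := range_windowOnes_eq_Icc (2 * n + 1)
  have hU' : Set.range (windowOnes (16 * n + 3)) = Set.Icc (l + 7 * n) (h + 7 * n + 2) := by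
    ext x
    constructor
    · rintro ⟨a, rfl⟩
      have hb : windowOnes (2 * n + 1) (a / 8) ∈ Set.Icc l h := hU ▸ ⟨_, rfl⟩
      have hw := windowOnes_sixteen_mul_add_three_bounds n (a / 8) (a % 8)
        (Nat.mod_lt _ (by norm_num))
      rw [Nat.div_add_mod] at hw
      rw [Set.mem_Icc] at hb ⊢
      omega
    · rintro ⟨hlx, hxh⟩
      obtain ⟨u, hu, e, he, rfl⟩ : ∃ u ∈ Set.Icc l h, ∃ e ≤ 2, u + 7 * n + e = x := by
        by_cases hx : x ≤ h + 7 * n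
        · exact ⟨x - 7 * n, ⟨by omega, by omega⟩, 0, by omega, by omega⟩
        · exact ⟨h, ⟨hlh, le_rfl⟩, x - (h + 7 * n), by omega, by omega⟩
      rw [← hU] at hu
      obtain ⟨b, rfl⟩ := hu
      exact exists_windowOnes_sixteen_mul_add_three n b e he
  rw [ρ_eq_ncard_range_windowOnes, ρ_eq_ncard_range_windowOnes, hU, hU',
    Set.ncard_eq_toFinset_card', Set.ncard_eq_toFinset_card', Set.toFinset_Icc,
    Set.toFinset_Icc, Nat.card_Icc, Nat.card_Icc]
  omega
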